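/- Let X ⊆ ℝ^d, let 𝒮 be a sample space, and let F : ℝ^d × 𝒮 → [0,∞) be a loss such that for every s ∈ 𝒮 the function F(·; s) is convex, differentiable, H-smooth, and satisfies inf_{x ∈ ℝ^d} F(x; s) = 0. Let S = (s₁, …, s_n) ∈ 𝒮^n be a dataset such that (F, S) is an interpolation problem over X and F_S has λ-quadratic growth on X. Let I ⊆ {1, …, n} with |I| = k, and define F_{S∖I}(x) = (1/n)·Σ_{i ∉ I} F(x; s_i). If λ·n > k·H, then F_{S∖I} has γ-quadratic growth on X for every γ ∈ (0, λ − k·H/n]. -/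

import Mathlib

open MeasureTheory Real

/-- The empirical risk `F_S(x) = (1/n)·Σᵢ F(x; sᵢ)` of a dataset `S`. -/
noncomputable def empRisk {E 𝒮 : Type*} {n : ℕ} (F : E → 𝒮 → ℝ) (S : Fin n → 𝒮) : E → ℝ :=
  fun x => (1 / n : ℝ) * ∑ i, F x (S i)

/-- The set of minimizers of `f` over `X`. -/
def argminOn {E : Type*} (f : E → ℝ) (X : Set E) : Set E := {x ∈ X | IsMinOn f X x}

/-- `(F, S)` is an interpolation problem over `X`: some minimizer `x*` of `F_S` over `X`
has `0 ∈ ∂F(x*; sᵢ)` for every `i` (for a convex loss, `0` is a subgradient of `F(·; sᵢ)`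
at `x*` iff `x*` minimizes `F(·; sᵢ)` globally). -/
def IsInterpolation {E 𝒮 : Type*} {n : ℕ} (F : E → 𝒮 → ℝ) (S : Fin n → 𝒮) (X : Set E) : Prop :=
  ∃ xstar ∈ X, IsMinOn (empRisk F S) X xstar ∧ ∀ i, ∀ y, F xstar (S i) ≤ F y (S i)

/-- `f` has `λ`-quadratic growth on `X`. -/
def QuadGrowthOn {E : Type*} [NormedAddCommGroup E] (f : E → ℝ) (X : Set E) (lam : ℝ) : Prop :=
  ∀ x ∈ X, f x - sInf (f '' argminOn f X) ≥ lam / 2 * (Metric.infDist x (argminOn f X)) ^ 2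

/-- The descent lemma for a function with `H`-Lipschitz gradient, at a global minimizer. -/
theorem sub_le_half_mul_norm_sub_sq_of_forall_le {E : Type*} [NormedAddCommGroup E]
    [InnerProductSpace ℝ E] [CompleteSpace E] {f : E → ℝ} {H : ℝ} {y : E}
    (hdiff : Differentiable ℝ f)
    (hsmooth : ∀ x z : E, ‖gradient f x - gradient f z‖ ≤ H * ‖x - z‖)
    (hmin : ∀ z, f y ≤ f z) (x : E) :
    f x - f y ≤ H / 2 * ‖x - y‖ ^ 2 := by
  have hgrad : gradient f y = 0 := by
    have h : fderiv ℝ f y = 0 :=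
      IsLocalMin.fderiv_eq_zero (Filter.Eventually.of_forall hmin)
    simp [gradient, h]
  set v := x - y with hv
  let h : ℝ → ℝ := fun t => H / 2 * ‖v‖ ^ 2 * t ^ 2 - f (y + t • v)
  have hderiv (t : ℝ) :
      HasDerivAt h (H * ‖v‖ ^ 2 * t - inner ℝ (gradient f (y + t • v)) v) t := by
    have hline : HasDerivAt (fun t : ℝ => y + t • v) v t := by
      simpa using ((hasDerivAt_id t).smul_const v).const_add y
    have hf := (hdiff (y + t • v)).hasGradientAt.hasFDerivAt.comp_hasDerivAt t hline
    have hsq := (hasDerivAt_pow 2 t).const_mul (H / 2 * ‖v‖ ^ 2)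
    refine (hsq.sub hf).congr_deriv ?_
    rw [InnerProductSpace.toDual_apply_apply]
    ring
  have hmono : MonotoneOn h (Set.Icc 0 1) := by
    refine monotoneOn_of_deriv_nonneg (convex_Icc 0 1)
      (fun t _ => (hderiv t).continuousAt.continuousWithinAt)
      (fun t _ => (hderiv t).differentiableAt.differentiableWithinAt) fun t ht => ?_
    rw [interior_Icc] at ht
    rw [(hderiv t).deriv, sub_nonneg]
    calc inner ℝ (gradient f (y + t • v)) v
        ≤ ‖gradient f (y + t • v)‖ * ‖v‖ := real_inner_le_norm _ _
      _ ≤ H * (t * ‖v‖) * ‖v‖ := by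
        gcongr
        simpa [hgrad, norm_smul, abs_of_pos ht.1] using hsmooth (y + t • v) y
      _ = H * ‖v‖ ^ 2 * t := by ring
  have h01 := hmono (Set.left_mem_Icc.2 zero_le_one) (Set.right_mem_Icc.2 zero_le_one) zero_le_one
  simp only [h, hv, zero_smul, add_zero, one_smul, add_sub_cancel] at h01
  linarith

/-- If `f` attains the value `0` on `X` and is nonnegative, its minimizers are its zeros. -/
theorem mem_argminOn_iff_of_eq_zero {E : Type*} {f : E → ℝ} {X : Set E} (hf : ∀ x, 0 ≤ f x)
    {z : E} (hz : z ∈ X) (hfz : f z = 0) {x : E} : x ∈ argminOn f X ↔ x ∈ X ∧ f x = 0 := by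
  refine and_congr_right fun _ => ⟨fun h => ?_, fun h y _ => ?_⟩
  · exact le_antisymm (hfz ▸ isMinOn_iff.1 h z hz) (hf x)
  · exact h.trans_le (hf y)

theorem sInf_image_argminOn_eq_zero {E : Type*} {f : E → ℝ} {X : Set E} (hf : ∀ x, 0 ≤ f x)
    {z : E} (hz : z ∈ X) (hfz : f z = 0) : sInf (f '' argminOn f X) = 0 := by
  have himage : f '' argminOn f X = {0} := by
    refine Set.eq_singleton_iff_unique_mem.2 ⟨⟨z, ?_, hfz⟩, ?_⟩
    · exact (mem_argminOn_iff_of_eq_zero hf hz hfz).2 ⟨hz, hfz⟩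
    · rintro _ ⟨x, hx, rfl⟩
      exact ((mem_argminOn_iff_of_eq_zero hf hz hfz).1 hx).2
  rw [himage, csInf_singleton]

/-- A bound `f x ≤ c * dist x y ^ 2` over all `y` in a nonempty set passes to the distance
to that set. -/
theorem le_mul_infDist_sq {E : Type*} [PseudoMetricSpace E] {A : Set E} (hA : A.Nonempty)
    {x : E} {a c : ℝ} (h : ∀ y ∈ A, a ≤ c * dist x y ^ 2) :
    a ≤ c * Metric.infDist x A ^ 2 := by
  obtain ⟨y, hy, hlim⟩ := mem_closure_iff_seq_limit.1
    (csInf_mem_closure (hA.image (dist x))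
      ⟨0, by rintro _ ⟨y, -, rfl⟩; exact dist_nonneg⟩)
  have hinf : sInf (dist x '' A) = Metric.infDist x A := by
    rw [Metric.infDist_eq_iInf, sInf_image']
  rw [hinf] at hlim
  refine ge_of_tendsto' ((hlim.pow 2).const_mul c) fun m => ?_
  obtain ⟨z, hz, hzm⟩ := hy m
  exact hzm ▸ h z hz

/-- Removing `k` samples from an interpolating dataset whose empirical
risk has `λ`-quadratic growth leaves a function with `γ`-quadratic growth for every
`γ ∈ (0, λ − kH/n]`, provided `λn > kH`. -/
theorem stmt_10 {𝒮 : Type*} (d n k : ℕ) (H lam : ℝ) (hH : 0 < H) (hlam : 0 < lam)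
    (hn : 0 < n)
    (X : Set (EuclideanSpace ℝ (Fin d)))
    (F : EuclideanSpace ℝ (Fin d) → 𝒮 → ℝ)
    (hnonneg : ∀ x s, 0 ≤ F x s)
    (hconv : ∀ s, ConvexOn ℝ Set.univ (fun x => F x s))
    (hdiff : ∀ s, Differentiable ℝ (fun x => F x s))
    (hsmooth : ∀ s, ∀ x y : EuclideanSpace ℝ (Fin d),
      ‖gradient (fun x => F x s) x - gradient (fun x => F x s) y‖ ≤ H * ‖x - y‖)
    (hinf : ∀ s, (⨅ x, F x s) = 0)
    (S : Fin n → 𝒮)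
    (hinterp : IsInterpolation F S X)
    (hgrowth : QuadGrowthOn (empRisk F S) X lam)
    (I : Finset (Fin n)) (hI : I.card = k)
    (hkn : lam * n > k * H) :
    ∀ γ : ℝ, 0 < γ → γ ≤ lam - k * H / n →
      QuadGrowthOn (fun x => (1 / n : ℝ) * ∑ i ∈ Iᶜ, F x (S i)) X γ := by
  intro γ hγ hγle x hx
  obtain ⟨z, hzX, -, hzmin⟩ := hinterp
  have hzero (i : Fin n) : F z (S i) = 0 :=
    le_antisymm ((le_ciInf (hzmin i)).trans_eq (hinf (S i))) (hnonneg z (S i))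
  have hn' : (0 : ℝ) < n := by exact_mod_cast hn
  set G : EuclideanSpace ℝ (Fin d) → ℝ := fun x => (1 / n : ℝ) * ∑ i ∈ Iᶜ, F x (S i) with hG
  have hG0 (x) : 0 ≤ G x := mul_nonneg (by positivity) (Finset.sum_nonneg fun i _ => hnonneg x _)
  have hR0 (x) : 0 ≤ empRisk F S x :=
    mul_nonneg (by positivity) (Finset.sum_nonneg fun i _ => hnonneg x _)
  have hGz : G z = 0 := by simp [hG, hzero]
  have hRz : empRisk F S z = 0 := by simp [empRisk, hzero]
  have hsplit (x) : empRisk F S x = (1 / n : ℝ) * ∑ i ∈ I, F x (S i) + G x := by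
    rw [hG, empRisk, ← mul_add, Finset.sum_add_sum_compl]
  set A := argminOn (empRisk F S) X
  have hzA : z ∈ A := (mem_argminOn_iff_of_eq_zero hR0 hzX hRz).2 ⟨hzX, hRz⟩
  have hAzero {y} (hy : y ∈ A) (i : Fin n) : F y (S i) = 0 := by
    have h := ((mem_argminOn_iff_of_eq_zero hR0 hzX hRz).1 hy).2
    rw [empRisk, mul_eq_zero, or_iff_right (by positivity),
      Finset.sum_eq_zero_iff_of_nonneg fun i _ => hnonneg y _] at h
    exact h i (Finset.mem_univ i)
  have hsub : A ⊆ argminOn G X := fun y hy =>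
    (mem_argminOn_iff_of_eq_zero hG0 hzX hGz).2 ⟨hy.1, by simp [hG, hAzero hy]⟩
  have hloss (i : Fin n) : F x (S i) ≤ H / 2 * Metric.infDist x A ^ 2 := by
    refine le_mul_infDist_sq ⟨z, hzA⟩ fun y hy => ?_
    have h := sub_le_half_mul_norm_sub_sq_of_forall_le (hdiff (S i)) (hsmooth (S i))
      (y := y) (fun w => (hAzero hy i).trans_le (hnonneg w _)) x
    simpa [hAzero hy i, dist_eq_norm] using h
  have hremoved : (1 / n : ℝ) * ∑ i ∈ I, F x (S i) ≤
      k * H / n / 2 * Metric.infDist x A ^ 2 := by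
    have h := Finset.sum_le_card_nsmul I (fun i => F x (S i)) _ fun i _ => hloss i
    rw [hI, nsmul_eq_mul] at h
    calc (1 / n : ℝ) * ∑ i ∈ I, F x (S i)
        ≤ (1 / n : ℝ) * (k * (H / 2 * Metric.infDist x A ^ 2)) := by gcongr
      _ = k * H / n / 2 * Metric.infDist x A ^ 2 := by ring
  have hgrow := hgrowth x hx
  rw [sInf_image_argminOn_eq_zero hR0 hzX hRz, sub_zero, hsplit] at hgrow
  rw [sInf_image_argminOn_eq_zero hG0 hzX hGz, sub_zero]
  calc γ / 2 * Metric.infDist x (argminOn G X) ^ 2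
      ≤ γ / 2 * Metric.infDist x A ^ 2 := by
        gcongr
        · exact Metric.infDist_nonneg
        · exact Metric.infDist_le_infDist_of_subset hsub ⟨z, hzA⟩
    _ ≤ (lam - k * H / n) / 2 * Metric.infDist x A ^ 2 := by gcongr
    _ ≤ G x := by linarith
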